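/- Fix a real Hilbert space V, an integer s ≥ 1 and real coefficients α_0, …, α_s with α_0 = α_1 = 1. Assume the energy identity: there are an integer k* with 1 ≤ k* ≤ s, reals β_{k*}, …, β_s, and symmetric reals (γ_{i,j})_{0≤i,j≤s−1} such that for every semi-negative continuous linear operator Z on V and every u0 ∈ V, ‖R(Z)u0‖² − ‖u0‖² = Σ_{k=k*}^s β_k ‖Z^k u0‖² + Σ_{i,j=0}^{s−1} γ_{i,j} [Z^i u0, Z^j u0]. Suppose the leading submatrix Γ* := (γ_{i,j})_{0≤i,j≤k*−1} is negative definite and ν < −β_{k*}/2. Then the modified method with purely diffusive superviscosity is strongly stable: there exists λ₀ > 0 such that for every semi-negative continuous linear operator Z on V with ‖Z‖ ≤ λ₀ and every u0 ∈ V, ‖u_M‖ ≤ ‖u0‖, where Z̃ := Z + ν(Z†)^{k*}Z^{k*} and u_M := R(Z̃) u0. -/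

import Mathlib

open RealInnerProductSpace ContinuousLinearMap

/-- The semi-inner-product `[v, w] := −⟨Zv, w⟩ − ⟨v, Zw⟩` associated with `Z`. -/
noncomputable def semiIP {V : Type*} [NormedAddCommGroup V] [InnerProductSpace ℝ V]
    (Z : V →L[ℝ] V) (v w : V) : ℝ :=
  -⟪Z v, w⟫ - ⟪v, Z w⟫

section semiIP
variable {V : Type*} [NormedAddCommGroup V] [InnerProductSpace ℝ V]

lemma semiIP_add_left (Z : V →L[ℝ] V) (v v' w : V) :
    semiIP Z (v + v') w = semiIP Z v w + semiIP Z v' w := by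
  simp only [semiIP, map_add, inner_add_left]; ring

lemma semiIP_add_right (Z : V →L[ℝ] V) (v w w' : V) :
    semiIP Z v (w + w') = semiIP Z v w + semiIP Z v w' := by
  simp only [semiIP, map_add, inner_add_right]; ring

lemma semiIP_smul_left (Z : V →L[ℝ] V) (c : ℝ) (v w : V) :
    semiIP Z (c • v) w = c * semiIP Z v w := by
  simp only [semiIP, map_smul, real_inner_smul_left]; ring

lemma semiIP_smul_right (Z : V →L[ℝ] V) (c : ℝ) (v w : V) :
    semiIP Z v (c • w) = c * semiIP Z v w := by
  simp only [semiIP, map_smul, real_inner_smul_right]; ring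

lemma semiIP_comm (Z : V →L[ℝ] V) (v w : V) : semiIP Z v w = semiIP Z w v := by
  simp only [semiIP, real_inner_comm]; ring

lemma semiIP_sum_left {ι : Type*} (Z : V →L[ℝ] V) (t : Finset ι) (f : ι → V) (w : V) :
    semiIP Z (∑ i ∈ t, f i) w = ∑ i ∈ t, semiIP Z (f i) w := by
  simp only [semiIP, map_sum, sum_inner, Finset.sum_sub_distrib, Finset.sum_neg_distrib]

lemma semiIP_sum_right {ι : Type*} (Z : V →L[ℝ] V) (t : Finset ι) (v : V) (f : ι → V) :
    semiIP Z v (∑ i ∈ t, f i) = ∑ i ∈ t, semiIP Z v (f i) := by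
  simp only [semiIP, map_sum, inner_sum, Finset.sum_sub_distrib, Finset.sum_neg_distrib]

lemma semiIP_self_nonneg {Z : V →L[ℝ] V} (hZ : ∀ v : V, ⟪Z v, v⟫ ≤ 0) (v : V) :
    0 ≤ semiIP Z v v := by
  have := hZ v
  rw [semiIP, real_inner_comm v (Z v)]
  rw [real_inner_comm] at this
  linarith

lemma abs_semiIP_le (Z : V →L[ℝ] V) (v w : V) :
    |semiIP Z v w| ≤ 2 * ‖Z‖ * (‖v‖ * ‖w‖) := by
  have h1 : |⟪Z v, w⟫| ≤ ‖Z‖ * ‖v‖ * ‖w‖ :=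
    (abs_real_inner_le_norm _ _).trans (by gcongr; exact Z.le_opNorm v)
  have h2 : |⟪v, Z w⟫| ≤ ‖v‖ * (‖Z‖ * ‖w‖) :=
    (abs_real_inner_le_norm _ _).trans (by gcongr; exact Z.le_opNorm w)
  rw [semiIP]
  rw [abs_le] at *
  constructor <;> linarith

/-- Young's inequality for the semi-inner-product, with the seminorm of the second argument
absorbed by the smallness of `Z`. -/
lemma abs_semiIP_le_mul_add {Z : V →L[ℝ] V} (hZ : ∀ v : V, ⟪Z v, v⟫ ≤ 0) {τ : ℝ} (hτ : 0 < τ)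
    (hZτ : ‖Z‖ ≤ τ ^ 2) (v w : V) :
    |semiIP Z v w| ≤ τ * (semiIP Z v v + ‖w‖ ^ 2) := by
  have hw : semiIP Z w w ≤ 2 * τ ^ 2 * ‖w‖ ^ 2 :=
    calc semiIP Z w w ≤ 2 * ‖Z‖ * (‖w‖ * ‖w‖) := (le_abs_self _).trans (abs_semiIP_le Z w w)
      _ ≤ 2 * τ ^ 2 * (‖w‖ * ‖w‖) := by gcongr
      _ = _ := by ring
  have hp := semiIP_self_nonneg hZ (τ • v + w)
  have hm := semiIP_self_nonneg hZ (τ • v + (-1 : ℝ) • w)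
  simp only [semiIP_add_left, semiIP_add_right, semiIP_smul_left, semiIP_smul_right,
    semiIP_comm Z w v] at hp hm
  have hv := semiIP_self_nonneg hZ v
  rw [abs_le]
  constructor <;> refine le_of_mul_le_mul_left ?_ hτ <;> nlinarith [sq_nonneg τ]

end semiIP

open scoped MatrixOrder in
/-- A positive definite matrix dominates a positive multiple of the identity. -/
lemma Matrix.PosDef.exists_posSemidef_sub_smul_one {n : Type*} [Fintype n] [DecidableEq n]
    [Nonempty n] {A : Matrix n n ℝ} (hA : A.PosDef) :
    ∃ ε : ℝ, 0 < ε ∧ (A - ε • (1 : Matrix n n ℝ)).PosSemidef := by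
  obtain ⟨ε, hε, h⟩ := (CFC.exists_pos_algebraMap_le_iff hA.isHermitian).2
    fun x hx => hA.isStrictlyPositive.spectrum_pos hx
  exact ⟨ε, hε, by rwa [Algebra.algebraMap_eq_smul_one] at h⟩

lemma Matrix.PosSemidef.sum_mul_semiIP_nonneg {V : Type*} [NormedAddCommGroup V]
    [InnerProductSpace ℝ V] {n : Type*} [Fintype n] {A : Matrix n n ℝ} (hA : A.PosSemidef)
    {Z : V →L[ℝ] V} (hZ : ∀ v : V, ⟪Z v, v⟫ ≤ 0) (a : n → V) :
    0 ≤ ∑ i, ∑ j, A i j * semiIP Z (a i) (a j) := by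
  obtain ⟨m, v, rfl⟩ := Matrix.posSemidef_iff_eq_sum_vecMulVec.1 hA
  have h : ∑ i, ∑ j, (∑ l, Matrix.vecMulVec (v l) (star (v l))) i j * semiIP Z (a i) (a j) =
      ∑ l, semiIP Z (∑ i, v l i • a i) (∑ i, v l i • a i) := by
    have hl (l : Fin m) : semiIP Z (∑ i, v l i • a i) (∑ i, v l i • a i) =
        ∑ i, ∑ j, v l i * v l j * semiIP Z (a i) (a j) := by
      rw [semiIP_sum_left]
      refine Finset.sum_congr rfl fun i _ => ?_
      rw [semiIP_smul_left, semiIP_sum_right, Finset.mul_sum]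
      refine Finset.sum_congr rfl fun j _ => ?_
      rw [semiIP_smul_right]
      ring
    simp only [hl, Matrix.sum_apply, Matrix.vecMulVec_apply, star_trivial, Finset.sum_mul]
    rw [Finset.sum_comm (s := (Finset.univ : Finset (Fin m)))]
    exact Finset.sum_congr rfl fun i _ => Finset.sum_comm
  rw [h]
  exact Finset.sum_nonneg fun l _ => semiIP_self_nonneg hZ _

lemma Matrix.PosDef.exists_mul_sum_semiIP_le {n : Type*} [Fintype n] [DecidableEq n] [Nonempty n]
    {A : Matrix n n ℝ} (hA : A.PosDef) (V : Type*) [NormedAddCommGroup V]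
    [InnerProductSpace ℝ V] :
    ∃ ε : ℝ, 0 < ε ∧ ∀ Z : V →L[ℝ] V, (∀ v : V, ⟪Z v, v⟫ ≤ 0) → ∀ a : n → V,
      ε * ∑ i, semiIP Z (a i) (a i) ≤ ∑ i, ∑ j, A i j * semiIP Z (a i) (a j) := by
  obtain ⟨ε, hε, h⟩ := hA.exists_posSemidef_sub_smul_one
  refine ⟨ε, hε, fun Z hZ a => ?_⟩
  have := h.sum_mul_semiIP_nonneg hZ a
  simp only [Matrix.sub_apply, Matrix.smul_apply, Matrix.one_apply, sub_mul, smul_eq_mul, mul_ite,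
    ite_mul, mul_one, mul_zero, zero_mul, Finset.sum_sub_distrib, Finset.sum_ite_eq,
    Finset.mem_univ, if_true, ← Finset.mul_sum] at this
  linarith

section identity
variable {V : Type*} [NormedAddCommGroup V] [InnerProductSpace ℝ V]

/-- An energy identity valid for all semi-negative operators is valid for all operators:
along `c ↦ W - c • 1` both sides are analytic, and `W - c • 1` is semi-negative for large `c`. -/
lemma energy_identity_of_semiNegative {s kst : ℕ} {α β : ℕ → ℝ} {γ : ℕ → ℕ → ℝ}
    (hidentity : ∀ Z : V →L[ℝ] V, (∀ v : V, ⟪Z v, v⟫ ≤ 0) → ∀ u0 : V,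
      ‖(∑ j ∈ Finset.range (s + 1), α j • Z ^ j) u0‖ ^ 2 - ‖u0‖ ^ 2
        = ∑ k ∈ Finset.Icc kst s, β k * ‖(Z ^ k) u0‖ ^ 2
          + ∑ i ∈ Finset.range s, ∑ j ∈ Finset.range s,
              γ i j * semiIP Z ((Z ^ i) u0) ((Z ^ j) u0))
    (W : V →L[ℝ] V) (u0 : V) :
    ‖(∑ j ∈ Finset.range (s + 1), α j • W ^ j) u0‖ ^ 2 - ‖u0‖ ^ 2
      = ∑ k ∈ Finset.Icc kst s, β k * ‖(W ^ k) u0‖ ^ 2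
        + ∑ i ∈ Finset.range s, ∑ j ∈ Finset.range s,
            γ i j * semiIP W ((W ^ i) u0) ((W ^ j) u0) := by
  have hX : ContDiff ℝ ⊤ (fun c : ℝ => W - c • (1 : V →L[ℝ] V)) := by fun_prop
  have hpow (j : ℕ) : ContDiff ℝ ⊤ (fun c : ℝ => (W - c • (1 : V →L[ℝ] V)) ^ j) := hX.pow j
  have hpu (j : ℕ) : ContDiff ℝ ⊤ (fun c : ℝ => ((W - c • (1 : V →L[ℝ] V)) ^ j) u0) :=
    (hpow j).clm_apply contDiff_const
  have hL : ContDiff ℝ ⊤ (fun c : ℝ =>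
      ‖(∑ j ∈ Finset.range (s + 1), α j • (W - c • (1 : V →L[ℝ] V)) ^ j) u0‖ ^ 2 - ‖u0‖ ^ 2) := by
    refine ContDiff.sub (ContDiff.norm_sq ℝ (ContDiff.clm_apply
      (ContDiff.sum fun j _ => (hpow j).const_smul (α j)) contDiff_const)) contDiff_const
  have hR : ContDiff ℝ ⊤ (fun c : ℝ =>
      ∑ k ∈ Finset.Icc kst s, β k * ‖((W - c • (1 : V →L[ℝ] V)) ^ k) u0‖ ^ 2
        + ∑ i ∈ Finset.range s, ∑ j ∈ Finset.range s,
            γ i j * semiIP (W - c • (1 : V →L[ℝ] V)) (((W - c • (1 : V →L[ℝ] V)) ^ i) u0)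
              (((W - c • (1 : V →L[ℝ] V)) ^ j) u0)) := by
    unfold semiIP
    refine ContDiff.add (ContDiff.sum fun k _ => contDiff_const.mul ((hpu k).norm_sq ℝ))
      (ContDiff.sum fun i _ => ContDiff.sum fun j _ => contDiff_const.mul (ContDiff.sub
        (ContDiff.neg (ContDiff.inner ℝ (hX.clm_apply (hpu i)) (hpu j)))
        (ContDiff.inner ℝ (hpu i) (hX.clm_apply (hpu j)))))
  have hev : ∀ c ≥ ‖W‖, ∀ v : V, ⟪(W - c • (1 : V →L[ℝ] V)) v, v⟫ ≤ 0 := by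
    intro c hc v
    have h1 : ⟪W v, v⟫ ≤ ‖W‖ * ‖v‖ * ‖v‖ :=
      (real_inner_le_norm _ _).trans (by gcongr; exact W.le_opNorm v)
    have h2 : ‖W‖ * ‖v‖ * ‖v‖ ≤ c * (‖v‖ * ‖v‖) := by rw [mul_assoc]; gcongr
    have h3 : ⟪(W - c • (1 : V →L[ℝ] V)) v, v⟫ = ⟪W v, v⟫ - c * (‖v‖ * ‖v‖) := by
      simp [inner_sub_left, real_inner_smul_left, ← pow_two]
    linarith
  have key := AnalyticOnNhd.eq_of_eventuallyEq (contDiff_omega_iff_analyticOnNhd.1 hL)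
    (contDiff_omega_iff_analyticOnNhd.1 hR) (z₀ := ‖W‖ + 1) (by
      filter_upwards [Ioi_mem_nhds (show ‖W‖ < ‖W‖ + 1 by linarith)] with c hc
      exact hidentity _ (hev c (le_of_lt hc)) u0)
  simpa using congrFun key 0

lemma energy_identity_gamma_zero [Nontrivial V] {s kst : ℕ} (hs : 1 ≤ s) (hk1 : 1 ≤ kst)
    {α β : ℕ → ℝ} {γ : ℕ → ℕ → ℝ} (hα0 : α 0 = 1) (hα1 : α 1 = 1)
    (hidentity : ∀ Z : V →L[ℝ] V, ∀ u0 : V,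
      ‖(∑ j ∈ Finset.range (s + 1), α j • Z ^ j) u0‖ ^ 2 - ‖u0‖ ^ 2
        = ∑ k ∈ Finset.Icc kst s, β k * ‖(Z ^ k) u0‖ ^ 2
          + ∑ i ∈ Finset.range s, ∑ j ∈ Finset.range s,
              γ i j * semiIP Z ((Z ^ i) u0) ((Z ^ j) u0)) :
    γ 0 0 = -1 := by
  obtain ⟨u, hu⟩ := exists_norm_eq V (zero_le_one (α := ℝ))
  have huu : ⟪u, u⟫ = 1 := by rw [real_inner_self_eq_norm_sq, hu]; norm_num
  have h (t : ℝ) : (∑ j ∈ Finset.range (s + 1), α j * t ^ j) ^ 2 - 1 =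
      ∑ k ∈ Finset.Icc kst s, β k * (t ^ k) ^ 2 + ∑ i ∈ Finset.range s, ∑ j ∈ Finset.range s,
        γ i j * (-2 * t * t ^ i * t ^ j) := by
    have hp (j : ℕ) : ((t • (1 : V →L[ℝ] V)) ^ j) u = t ^ j • u := by
      rw [smul_pow, one_pow]; rfl
    have := hidentity (t • 1) u
    simp only [sum_apply, smul_apply, hp, smul_smul,
      ← Finset.sum_smul, norm_smul, hu, mul_one, Real.norm_eq_abs, sq_abs, one_pow] at this
    rw [this]
    congr 1
    refine Finset.sum_congr rfl fun i _ => Finset.sum_congr rfl fun j _ => ?_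
    simp only [semiIP, smul_apply, one_apply_eq_self,
      real_inner_smul_left, real_inner_smul_right, huu]
    ring
  have hL : HasDerivAt (fun t : ℝ => (∑ j ∈ Finset.range (s + 1), α j * t ^ j) ^ 2 - 1) 2 0 := by
    have := ((HasDerivAt.fun_sum fun j (_ : j ∈ Finset.range (s + 1)) =>
      (hasDerivAt_pow j (0 : ℝ)).const_mul (α j)).pow 2).sub_const 1
    refine this.congr_deriv ?_
    rw [Finset.sum_eq_single 0, Finset.sum_eq_single 1]
    · simp [hα0, hα1]
    · intro j _ hj
      rcases j with _ | _ | j <;> simp_all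
    · intro h1; simp at h1; omega
    · intro j _ hj; simp [hj]
    · simp
  have hR : HasDerivAt (fun t : ℝ => ∑ k ∈ Finset.Icc kst s, β k * (t ^ k) ^ 2 +
      ∑ i ∈ Finset.range s, ∑ j ∈ Finset.range s, γ i j * (-2 * t * t ^ i * t ^ j))
      (-2 * γ 0 0) 0 := by
    have := (HasDerivAt.fun_sum fun k (_ : k ∈ Finset.Icc kst s) =>
      ((hasDerivAt_pow k (0 : ℝ)).pow 2).const_mul (β k)).add
      (HasDerivAt.fun_sum fun i (_ : i ∈ Finset.range s) =>
        HasDerivAt.fun_sum fun j (_ : j ∈ Finset.range s) =>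
          ((((hasDerivAt_id (0 : ℝ)).const_mul (-2)).mul (hasDerivAt_pow i 0)).mul
            (hasDerivAt_pow j 0)).const_mul (γ i j))
    refine this.congr_deriv ?_
    rw [Finset.sum_eq_zero, Finset.sum_eq_single 0, Finset.sum_eq_single 0]
    · simp; ring
    · intro j _ hj; simp [hj]
    · intro h0; simp at h0; omega
    · intro i _ hi; simp [hi]
    · intro h0; simp at h0; omega
    · intro k hk
      have : k ≠ 0 := by have := (Finset.mem_Icc.1 hk).1; omega
      simp [this]
  have := hL.unique ((funext h : _ = _) ▸ hR)
  linarith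

end identity

section perturbation
variable {V : Type*} [NormedAddCommGroup V] [InnerProductSpace ℝ V]

lemma norm_pow_add_apply_le (Z : V →L[ℝ] V) (i k : ℕ) (u : V) :
    ‖(Z ^ (i + k)) u‖ ≤ ‖Z‖ ^ i * ‖(Z ^ k) u‖ := by
  induction i with
  | zero => simp
  | succ i ih =>
    rw [show i + 1 + k = (i + k) + 1 by ring, pow_succ', mul_apply_eq_comp, pow_succ', mul_assoc]
    exact (Z.le_opNorm _).trans (by gcongr)

/-- Adding the superviscosity `ν (Z†)^k Z^k` perturbs `Z ^ i u` by a small multiple of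
`‖Z ^ k u‖`. -/
lemma norm_superviscosity_pow_sub_le [CompleteSpace V] {Z : V →L[ℝ] V} {τ : ℝ} (hτ1 : τ ≤ 1)
    (hZτ : ‖Z‖ ≤ τ) {k : ℕ} (hk : 1 ≤ k) (ν : ℝ) (u : V) (i : ℕ) :
    ‖((Z + ν • (adjoint Z ^ k * Z ^ k)) ^ i) u - (Z ^ i) u‖
      ≤ (2 * (1 + |ν|)) ^ i * (τ * ‖(Z ^ k) u‖) := by
  have hτ0 : 0 ≤ τ := (norm_nonneg Z).trans hZτ
  have hZ1 : ‖Z‖ ≤ 1 := hZτ.trans hτ1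
  have hadj : ‖adjoint Z‖ = ‖Z‖ := LinearIsometryEquiv.norm_map _ _
  have hpow (W : V →L[ℝ] V) : ‖W ^ k‖ ≤ ‖W‖ ^ k := norm_pow_le' W hk
  have hZk : ‖Z ^ k‖ ≤ 1 := (hpow Z).trans (pow_le_one₀ (norm_nonneg _) hZ1)
  have hZak : ‖adjoint Z ^ k‖ ≤ τ := by
    refine (hpow _).trans ?_
    rw [hadj]
    exact (pow_le_of_le_one (norm_nonneg _) hZ1 (by omega)).trans hZτ
  have hW : ‖Z + ν • (adjoint Z ^ k * Z ^ k)‖ ≤ 1 + |ν| := by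
    refine (norm_add_le _ _).trans (add_le_add hZ1 ?_)
    rw [norm_smul, Real.norm_eq_abs]
    refine mul_le_of_le_one_right (abs_nonneg _) ((norm_mul_le _ _).trans ?_)
    exact mul_le_one₀ (hZak.trans hτ1) (norm_nonneg _) hZk
  induction i with
  | zero => simp; positivity
  | succ i ih =>
    set W := Z + ν • (adjoint Z ^ k * Z ^ k) with hWdef
    have hsplit : (W ^ (i + 1)) u - (Z ^ (i + 1)) u =
        W ((W ^ i) u - (Z ^ i) u) + ν • (adjoint Z ^ k) ((Z ^ (i + k)) u) := by
      have hD : W ((Z ^ i) u) = Z ((Z ^ i) u) + ν • (adjoint Z ^ k) ((Z ^ (i + k)) u) := by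
        rw [add_comm i k, pow_add, hWdef]; rfl
      rw [pow_succ', pow_succ', mul_apply_eq_comp, mul_apply_eq_comp, map_sub, hD]
      abel
    have hik : ‖(Z ^ (i + k)) u‖ ≤ ‖(Z ^ k) u‖ :=
      (norm_pow_add_apply_le Z i k u).trans
        (mul_le_of_le_one_left (norm_nonneg _) (pow_le_one₀ (norm_nonneg _) hZ1))
    have h2 : ‖ν • (adjoint Z ^ k) ((Z ^ (i + k)) u)‖ ≤ |ν| * (τ * ‖(Z ^ k) u‖) := by
      rw [norm_smul, Real.norm_eq_abs]
      gcongr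
      exact (le_opNorm _ _).trans (by gcongr)
    have h1 : ‖W ((W ^ i) u - (Z ^ i) u)‖ ≤
        (1 + |ν|) * ((2 * (1 + |ν|)) ^ i * (τ * ‖(Z ^ k) u‖)) :=
      (W.le_opNorm _).trans (by gcongr)
    have hone : 1 ≤ (2 * (1 + |ν|)) ^ i := one_le_pow₀ (by linarith [abs_nonneg ν])
    have h3 : |ν| * (τ * ‖(Z ^ k) u‖) ≤
        (1 + |ν|) * ((2 * (1 + |ν|)) ^ i * (τ * ‖(Z ^ k) u‖)) :=
      mul_le_mul (by linarith) (le_mul_of_one_le_left (by positivity) hone)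
        (by positivity) (by positivity)
    rw [hsplit, pow_succ]
    refine (norm_add_le _ _).trans ?_
    linarith

lemma abs_semiIP_add_add_sub_le {Z : V →L[ℝ] V} (hZ : ∀ v : V, ⟪Z v, v⟫ ≤ 0) {τ B : ℝ}
    (hτ : 0 < τ) (hτ1 : τ ≤ 1) (hZτ : ‖Z‖ ≤ τ ^ 2) (p q : V) {r t : V} (hr : ‖r‖ ≤ B)
    (ht : ‖t‖ ≤ B) :
    |semiIP Z (p + r) (q + t) - semiIP Z p q|
      ≤ τ * (semiIP Z p p + semiIP Z q q + 4 * B ^ 2) := by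
  have hB : 0 ≤ B := (norm_nonneg r).trans hr
  have hττ : τ ^ 2 ≤ τ := pow_le_of_le_one hτ.le hτ1 two_ne_zero
  have h1 : |semiIP Z p t| ≤ τ * (semiIP Z p p + B ^ 2) :=
    (abs_semiIP_le_mul_add hZ hτ hZτ p t).trans (by gcongr)
  have h2 : |semiIP Z q r| ≤ τ * (semiIP Z q q + B ^ 2) :=
    (abs_semiIP_le_mul_add hZ hτ hZτ q r).trans (by gcongr)
  have h3 : |semiIP Z r t| ≤ 2 * τ * (B * B) :=
    (abs_semiIP_le Z r t).trans (by gcongr; exact hZτ.trans hττ)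
  have : semiIP Z (p + r) (q + t) - semiIP Z p q =
      semiIP Z p t + semiIP Z q r + semiIP Z r t := by
    simp only [semiIP_add_left, semiIP_add_right, semiIP_comm Z r q]; ring
  rw [this]
  refine (abs_add_three _ _ _).trans ?_
  linarith

lemma semiIP_superviscosity [CompleteSpace V] (Z : V →L[ℝ] V) (k : ℕ) (ν : ℝ) (v w : V) :
    semiIP (Z + ν • (adjoint Z ^ k * Z ^ k)) v w
      = semiIP Z v w - 2 * ν * ⟪(Z ^ k) v, (Z ^ k) w⟫ := by
  have hadj : adjoint Z ^ k = adjoint (Z ^ k) := (star_pow Z k).symm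
  simp only [semiIP, hadj, add_apply, smul_apply, mul_apply_eq_comp, inner_add_left,
    inner_add_right, real_inner_smul_left, real_inner_smul_right, adjoint_inner_left,
    adjoint_inner_right]
  ring

end perturbation

lemma Finset.sum_mul_le_sum_mul_add {ι : Type*} (t : Finset ι) (c f g : ι → ℝ) {E : ℝ}
    (h : ∀ i ∈ t, |f i - g i| ≤ E) :
    ∑ i ∈ t, c i * f i ≤ ∑ i ∈ t, c i * g i + (∑ i ∈ t, |c i|) * E := by
  rw [Finset.sum_mul, ← Finset.sum_add_distrib]
  refine Finset.sum_le_sum fun i hi => ?_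
  have h1 : c i * (f i - g i) ≤ |c i| * E :=
    (le_abs_self _).trans (by rw [abs_mul]; gcongr; exact h i hi)
  linarith

section energy
variable {V : Type*} [NormedAddCommGroup V] [InnerProductSpace ℝ V] [CompleteSpace V]

/-- For `‖Z‖ ≤ τ²` with `τ` small, the quantities in the energy identity of the modified operator
differ from their leading parts by at most `O(τ)` times the available dissipation `x² + G`. -/
lemma superviscosity_term_estimates {Z : V →L[ℝ] V} (hZ : ∀ v : V, ⟪Z v, v⟫ ≤ 0) {τ : ℝ}
    (hτ : 0 < τ) (hτ1 : τ ≤ 1) (hZτ : ‖Z‖ ≤ τ ^ 2) {k s : ℕ} (hk : 1 ≤ k) (ν : ℝ) (u : V)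
    {M : ℝ} (hM : M = (2 * (1 + |ν|)) ^ s) :
    (∀ l ∈ Finset.Icc k s, |‖((Z + ν • (adjoint Z ^ k * Z ^ k)) ^ l) u‖ ^ 2
        - (if l = k then ‖(Z ^ k) u‖ ^ 2 else 0)| ≤ 4 * M ^ 2 * τ * ‖(Z ^ k) u‖ ^ 2) ∧
    ∀ i ∈ Finset.range s, ∀ j ∈ Finset.range s,
      |semiIP (Z + ν • (adjoint Z ^ k * Z ^ k)) (((Z + ν • (adjoint Z ^ k * Z ^ k)) ^ i) u)
          (((Z + ν • (adjoint Z ^ k * Z ^ k)) ^ j) u)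
        - (semiIP Z (if i < k then (Z ^ i) u else 0) (if j < k then (Z ^ j) u else 0)
          - 2 * ν * (if i = 0 ∧ j = 0 then ‖(Z ^ k) u‖ ^ 2 else 0))|
        ≤ 16 * (1 + |ν|) * M ^ 2 * τ *
          (‖(Z ^ k) u‖ ^ 2 + ∑ m ∈ Finset.range k, semiIP Z ((Z ^ m) u) ((Z ^ m) u)) := by
  have hZτ' : ‖Z‖ ≤ τ := hZτ.trans (pow_le_of_le_one hτ.le hτ1 two_ne_zero)
  have hZ1 : ‖Z‖ ≤ 1 := hZτ'.trans hτ1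
  have hM1 : 1 ≤ M := hM ▸ one_le_pow₀ (by linarith [abs_nonneg ν])
  set W := Z + ν • (adjoint Z ^ k * Z ^ k) with hW
  set x := ‖(Z ^ k) u‖ with hx
  have hx0 : 0 ≤ x := norm_nonneg _
  set G := ∑ m ∈ Finset.range k, semiIP Z ((Z ^ m) u) ((Z ^ m) u) with hG
  have hG0 : 0 ≤ G := Finset.sum_nonneg fun m _ => semiIP_self_nonneg hZ _
  have herr (i : ℕ) (hi : i ≤ s) : ‖(W ^ i) u - (Z ^ i) u‖ ≤ M * (τ * x) := by
    refine (norm_superviscosity_pow_sub_le hτ1 hZτ' hk ν u i).trans ?_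
    rw [hM]
    gcongr
    linarith [abs_nonneg ν]
  have hZpow (i : ℕ) (hi : i ≠ 0) : ‖Z‖ ^ i ≤ τ :=
    (pow_le_of_le_one (norm_nonneg _) hZ1 hi).trans hZτ'
  have hlow (i : ℕ) (hi : i ≠ 0) : ‖(Z ^ (i + k)) u‖ ≤ τ * x :=
    (norm_pow_add_apply_le Z i k u).trans (by gcongr; exact hZpow i hi)
  have hMx : M * (τ * x) ≤ M * x := by
    gcongr; exact mul_le_of_le_one_left hx0 hτ1
  have hττ : τ ^ 2 ≤ τ := pow_le_of_le_one hτ.le hτ1 two_ne_zero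
  refine ⟨fun l hl => ?_, fun i hi j hj => ?_⟩
  · obtain ⟨hkl, hls⟩ := Finset.mem_Icc.1 hl
    have he := herr l hls
    split_ifs with h
    · subst h
      have h1 : |‖(W ^ l) u‖ - x| ≤ M * (τ * x) := (abs_norm_sub_norm_le _ _).trans he
      have h2 : ‖(W ^ l) u‖ + x ≤ 3 * (M * x) := by
        have := (abs_le.1 h1).2
        have : x ≤ M * x := le_mul_of_one_le_left hx0 hM1
        linarith
      calc |‖(W ^ l) u‖ ^ 2 - x ^ 2| = |‖(W ^ l) u‖ - x| * (‖(W ^ l) u‖ + x) := by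
            rw [← abs_of_nonneg (show 0 ≤ ‖(W ^ l) u‖ + x by positivity), ← abs_mul]
            congr 1; ring
        _ ≤ M * (τ * x) * (3 * (M * x)) := by gcongr
        _ ≤ 4 * M ^ 2 * τ * x ^ 2 := by
            have : 0 ≤ M ^ 2 * τ * x ^ 2 := by positivity
            linarith
    · have h1 : ‖(Z ^ l) u‖ ≤ τ * x := by
        have := hlow (l - k) (by omega)
        rwa [Nat.sub_add_cancel hkl] at this
      have h2 : ‖(W ^ l) u‖ ≤ 2 * M * τ * x := by
        have h3 := norm_le_norm_add_norm_sub' ((W ^ l) u) ((Z ^ l) u)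
        have : τ * x ≤ M * (τ * x) := le_mul_of_one_le_left (by positivity) hM1
        linarith
      rw [sub_zero, abs_of_nonneg (by positivity)]
      calc ‖(W ^ l) u‖ ^ 2 ≤ (2 * M * τ * x) ^ 2 := by gcongr
        _ = 4 * M ^ 2 * τ ^ 2 * x ^ 2 := by ring
        _ ≤ _ := by gcongr
  · have his := (Finset.mem_range.1 hi).le
    have hjs := (Finset.mem_range.1 hj).le
    have hrem (i : ℕ) (hi : i ≤ s) :
        ‖(W ^ i) u - (if i < k then (Z ^ i) u else 0)‖ ≤ 2 * M * x := by
      have he := (herr i hi).trans hMx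
      have : x ≤ M * x := le_mul_of_one_le_left hx0 hM1
      split_ifs with h
      · linarith
      · rw [sub_zero]
        have h3 := norm_le_norm_add_norm_sub' ((W ^ i) u) ((Z ^ i) u)
        have h4 : ‖(Z ^ i) u‖ ≤ x := by
          have := norm_pow_add_apply_le Z (i - k) k u
          rw [Nat.sub_add_cancel (not_lt.1 h)] at this
          exact this.trans (mul_le_of_le_one_left hx0 (pow_le_one₀ (norm_nonneg _) hZ1))
        linarith
    have hdiss (i : ℕ) : semiIP Z (if i < k then (Z ^ i) u else 0)
        (if i < k then (Z ^ i) u else 0) ≤ G := by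
      split_ifs with h
      · exact Finset.single_le_sum (f := fun m => semiIP Z ((Z ^ m) u) ((Z ^ m) u))
          (fun m _ => semiIP_self_nonneg hZ _) (Finset.mem_range.2 h)
      · simpa [semiIP] using hG0
    have hsemi := abs_semiIP_add_add_sub_le hZ hτ hτ1 hZτ (if i < k then (Z ^ i) u else 0)
      (if j < k then (Z ^ j) u else 0) (hrem i his) (hrem j hjs)
    rw [add_sub_cancel, add_sub_cancel] at hsemi
    have hsemi' : τ * (semiIP Z (if i < k then (Z ^ i) u else 0) (if i < k then (Z ^ i) u else 0)
        + semiIP Z (if j < k then (Z ^ j) u else 0) (if j < k then (Z ^ j) u else 0)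
        + 4 * (2 * M * x) ^ 2) ≤ τ * (G + G + 4 * (2 * M * x) ^ 2) := by
      gcongr
      · exact hdiss i
      · exact hdiss j
    have hsmall (i : ℕ) (hi : i ≤ s) (hi0 : i ≠ 0) : ‖(Z ^ k) ((W ^ i) u)‖ ≤ 2 * M * τ * x := by
      have h1 : (Z ^ k) ((W ^ i) u) = (Z ^ (i + k)) u + (Z ^ k) ((W ^ i) u - (Z ^ i) u) := by
        rw [add_comm i k, pow_add, mul_apply_eq_comp, map_sub]; abel
      have h2 : ‖(Z ^ k) ((W ^ i) u - (Z ^ i) u)‖ ≤ 1 * (M * (τ * x)) := by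
        refine (le_opNorm _ _).trans ?_
        gcongr
        · exact (norm_pow_le' Z hk).trans (pow_le_one₀ (norm_nonneg _) hZ1)
        · exact herr i hi
      have : τ * x ≤ M * (τ * x) := le_mul_of_one_le_left (by positivity) hM1
      rw [h1]
      refine (norm_add_le _ _).trans ?_
      linarith [hlow i hi0]
    have hbdd (i : ℕ) (hi : i ≤ s) : ‖(Z ^ k) ((W ^ i) u)‖ ≤ 2 * M * x := by
      rcases eq_or_ne i 0 with rfl | hi0
      · have : x ≤ M * x := le_mul_of_one_le_left hx0 hM1
        simp only [pow_zero, one_apply_eq_self]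
        linarith
      · refine (hsmall i hi hi0).trans ?_
        linarith
    have hvisc : |⟪(Z ^ k) ((W ^ i) u), (Z ^ k) ((W ^ j) u)⟫
        - (if i = 0 ∧ j = 0 then x ^ 2 else 0)| ≤ 4 * M ^ 2 * τ * x ^ 2 := by
      split_ifs with h
      · rw [h.1, h.2, pow_zero, one_apply_eq_self, real_inner_self_eq_norm_sq, sub_self, abs_zero]
        positivity
      · rw [sub_zero]
        refine (abs_real_inner_le_norm _ _).trans ?_
        rcases eq_or_ne i 0 with hi0 | hi0
        · calc _ ≤ (2 * M * x) * (2 * M * τ * x) := by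
                gcongr
                · exact hbdd i his
                · exact hsmall j hjs fun hj0 => h ⟨hi0, hj0⟩
            _ = _ := by ring
        · calc _ ≤ (2 * M * τ * x) * (2 * M * x) := by
                gcongr
                · exact hsmall i his hi0
                · exact hbdd j hjs
            _ = _ := by ring
    rw [hW, semiIP_superviscosity, ← hW]
    set P := semiIP Z ((W ^ i) u) ((W ^ j) u)
    set P' := semiIP Z (if i < k then (Z ^ i) u else 0) (if j < k then (Z ^ j) u else 0)
    set Q := ⟪(Z ^ k) ((W ^ i) u), (Z ^ k) ((W ^ j) u)⟫
    set Q' := if i = 0 ∧ j = 0 then x ^ 2 else 0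
    have hM2 : 1 ≤ M ^ 2 := one_le_pow₀ hM1
    calc |P - 2 * ν * Q - (P' - 2 * ν * Q')| = |(P - P') + (-(2 * ν)) * (Q - Q')| := by ring_nf
      _ ≤ |P - P'| + 2 * |ν| * |Q - Q'| := by
          refine (abs_add_le _ _).trans_eq ?_
          rw [abs_mul, abs_neg, abs_mul, abs_two]
      _ ≤ τ * (G + G + 4 * (2 * M * x) ^ 2) + 2 * |ν| * (4 * M ^ 2 * τ * x ^ 2) := by
          gcongr
          exact hsemi.trans hsemi'
      _ ≤ _ := by
          have h1 : τ * G ≤ M ^ 2 * (τ * G) := le_mul_of_one_le_left (by positivity) hM2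
          have h2 : 0 ≤ M ^ 2 * (τ * G) := by positivity
          have h3 : 0 ≤ |ν| * (M ^ 2 * (τ * G)) := by positivity
          have h4 : 0 ≤ |ν| * (M ^ 2 * τ * x ^ 2) := by positivity
          linarith

end energy

/-- strong stability of the modified method with purely diffusive
superviscosity `ν < −β_{k*}/2`, assuming the leading submatrix `Γ*` is negative definite. -/
theorem modified_diffusive_strongly_stable
    {V : Type*} [NormedAddCommGroup V] [InnerProductSpace ℝ V] [CompleteSpace V]
    (s : ℕ) (hs : 1 ≤ s) (α : ℕ → ℝ) (hα0 : α 0 = 1) (hα1 : α 1 = 1)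
    (kst : ℕ) (hk1 : 1 ≤ kst) (hks : kst ≤ s)
    (β : ℕ → ℝ) (γ : ℕ → ℕ → ℝ) (hsym : ∀ i j, γ i j = γ j i)
    (hidentity : ∀ Z : V →L[ℝ] V, (∀ v : V, ⟪Z v, v⟫ ≤ 0) → ∀ u0 : V,
      ‖(∑ j ∈ Finset.range (s + 1), α j • Z ^ j) u0‖ ^ 2 - ‖u0‖ ^ 2
        = ∑ k ∈ Finset.Icc kst s, β k * ‖(Z ^ k) u0‖ ^ 2
          + ∑ i ∈ Finset.range s, ∑ j ∈ Finset.range s,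
              γ i j * semiIP Z ((Z ^ i) u0) ((Z ^ j) u0))
    (hmat : (-(Matrix.of (fun i j : Fin kst => γ i j))).PosDef)
    (ν : ℝ) (hν : ν < -β kst / 2) :
    ∃ lam0 : ℝ, 0 < lam0 ∧
      ∀ Z : V →L[ℝ] V, (∀ v : V, ⟪Z v, v⟫ ≤ 0) → ‖Z‖ ≤ lam0 → ∀ u0 : V,
        ‖(∑ j ∈ Finset.range (s + 1),
            α j • (Z + ν • (adjoint Z ^ kst * Z ^ kst)) ^ j) u0‖ ≤ ‖u0‖ := by
  rcases subsingleton_or_nontrivial V with hV | hV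
  · exact ⟨1, one_pos, fun Z _ _ u0 => by simp [Subsingleton.elim _ (0 : V)]⟩
  have hid := energy_identity_of_semiNegative hidentity
  have hγ0 : γ 0 0 = -1 := energy_identity_gamma_zero hs hk1 hα0 hα1 hid
  have : Nonempty (Fin kst) := ⟨⟨0, hk1⟩⟩
  obtain ⟨ε, hε, hcoer⟩ := hmat.exists_mul_sum_semiIP_le V
  set M := (2 * (1 + |ν|)) ^ s with hM
  set Cβ := (∑ l ∈ Finset.Icc kst s, |β l|) * (4 * M ^ 2) with hCβ
  set Cγ := (∑ i ∈ Finset.range s, ∑ j ∈ Finset.range s, |γ i j|) *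
    (16 * (1 + |ν|) * M ^ 2) with hCγ
  have hCβ0 : 0 ≤ Cβ := by positivity
  have hCγ0 : 0 ≤ Cγ := by positivity
  obtain ⟨δ, hδ, hδε, hδν⟩ : ∃ δ : ℝ, 0 < δ ∧ δ ≤ ε ∧ δ ≤ -(β kst + 2 * ν) :=
    ⟨min ε (-(β kst + 2 * ν)), lt_min hε (by linarith), min_le_left _ _, min_le_right _ _⟩
  set τ := min 1 (δ / (Cβ + Cγ + 1)) with hτdef
  have hτ : 0 < τ := lt_min one_pos (by positivity)
  have hτ1 : τ ≤ 1 := min_le_left _ _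
  have hτδ : (Cβ + Cγ) * τ ≤ δ := by
    have : τ * (Cβ + Cγ + 1) ≤ δ := (le_div_iff₀ (by positivity)).1 (min_le_right _ _)
    linarith
  refine ⟨τ ^ 2, by positivity, fun Z hZ hZτ u => ?_⟩
  obtain ⟨hβ, hγ⟩ := superviscosity_term_estimates hZ hτ hτ1 hZτ (s := s) hk1 ν u hM
  have hE := hid (Z + ν • (adjoint Z ^ kst * Z ^ kst)) u
  set W := Z + ν • (adjoint Z ^ kst * Z ^ kst)
  set x := ‖(Z ^ kst) u‖
  set G := ∑ m ∈ Finset.range kst, semiIP Z ((Z ^ m) u) ((Z ^ m) u) with hG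
  have hG0 : 0 ≤ G := Finset.sum_nonneg fun m _ => semiIP_self_nonneg hZ _
  have hβsum : ∑ l ∈ Finset.Icc kst s, β l * ‖(W ^ l) u‖ ^ 2 ≤ β kst * x ^ 2 + Cβ * τ * x ^ 2 := by
    refine (Finset.sum_mul_le_sum_mul_add _ _ _ _ hβ).trans_eq ?_
    simp only [mul_ite, mul_zero, Finset.sum_ite_eq', Finset.left_mem_Icc, hks, if_true]
    rw [hCβ]; ring
  set p : ℕ → V := fun i => if i < kst then (Z ^ i) u else 0 with hp
  have hγsum : ∑ i ∈ Finset.range s, ∑ j ∈ Finset.range s,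
      γ i j * semiIP W ((W ^ i) u) ((W ^ j) u) ≤
      ∑ i ∈ Finset.range s, ∑ j ∈ Finset.range s, γ i j * semiIP Z (p i) (p j)
        + 2 * ν * x ^ 2 + Cγ * τ * (x ^ 2 + G) := by
    refine (Finset.sum_le_sum fun i hi =>
      Finset.sum_mul_le_sum_mul_add _ _ _ _ (hγ i hi)).trans_eq ?_
    have h0 : ∑ i ∈ Finset.range s, ∑ j ∈ Finset.range s,
        γ i j * (2 * ν * (if i = 0 ∧ j = 0 then x ^ 2 else 0)) = -(2 * ν * x ^ 2) := by
      rw [Finset.sum_eq_single 0, Finset.sum_eq_single 0]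
      · simp [hγ0]
      · intro j _ hj; simp [hj]
      · intro h; simp at h; omega
      · intro i _ hi; simp [hi]
      · intro h; simp at h; omega
    simp only [mul_sub, Finset.sum_add_distrib, Finset.sum_sub_distrib, ← Finset.sum_mul, h0]
    rw [hCγ]; ring
  have hmain : ∑ i ∈ Finset.range s, ∑ j ∈ Finset.range s, γ i j * semiIP Z (p i) (p j)
      ≤ -(ε * G) := by
    have hzero (i : ℕ) (hi : i ∉ Finset.range kst) : p i = 0 := if_neg (by simpa using hi)
    have hsub : Finset.range kst ⊆ Finset.range s := Finset.range_mono hks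
    have h1 : ∑ i ∈ Finset.range s, ∑ j ∈ Finset.range s, γ i j * semiIP Z (p i) (p j) =
        ∑ i : Fin kst, ∑ j : Fin kst, γ i j * semiIP Z (p i) (p j) := by
      rw [← Finset.sum_subset hsub fun i _ hi => by simp [hzero i hi, semiIP], Finset.sum_range]
      refine Finset.sum_congr rfl fun i _ => ?_
      rw [← Finset.sum_subset hsub fun j _ hj => by simp [hzero j hj, semiIP], Finset.sum_range]
    have h2 := hcoer Z hZ fun i => p i
    have h3 : ∑ i : Fin kst, semiIP Z (p i) (p i) = G := by
      rw [hG, Finset.sum_range]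
      exact Finset.sum_congr rfl fun i _ => by simp [hp]
    simp only [Matrix.neg_apply, Matrix.of_apply, neg_mul, Finset.sum_neg_distrib] at h2
    rw [h3] at h2
    rw [h1]
    linarith
  have hτx : (Cβ + Cγ) * τ * x ^ 2 ≤ -(β kst + 2 * ν) * x ^ 2 := by
    gcongr; exact hτδ.trans hδν
  have hτG : Cγ * τ * G ≤ ε * G := by
    gcongr
    have : 0 ≤ Cβ * τ := by positivity
    linarith
  have hle : ‖(∑ j ∈ Finset.range (s + 1), α j • W ^ j) u‖ ^ 2 ≤ ‖u‖ ^ 2 := by linarith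
  exact (sq_le_sq₀ (norm_nonneg _) (norm_nonneg _)).1 hle
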